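/- arXiv:2006.15361 — 2 statements merged into one kernel-verified Lean document; each statement's English description precedes it below -/
import Mathlib

section
/- Let d be a squarefree positive integer with discriminant Δ_d > (4·4!·4!·15⁴)², let F = ℚ(√d), and let L be a positive definite classic universal quadratic 𝒪_F-lattice. For each k = 1, 2, …, 15, choose v_k ∈ L with Q(v_k) = m_k + k·ω_d, where m_k = −⌊k·ω̄_d⌋ (such v_k exist since m_k + k·ω_d is totally positive and L is universal). Let L₂ be the 𝒪_F-submodule of L generated by {v₁, …, v₁₅}. Then rank(L₂) ≥ 4. -/
noncomputable section

/-- `Δ_d`: the discriminant of `ℚ(√d)` for squarefree `d > 1`. -/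
def Delta (d : ℕ) : ℕ := if d % 4 = 1 then d else 4 * d

/-- `ω_d`, viewed as a real number (with `√d > 0`). -/
def omegaR (d : ℕ) : ℝ := if d % 4 = 1 then (1 + Real.sqrt d) / 2 else Real.sqrt d

/-- The conjugate `ω̄_d`, viewed as a real number. -/
def omegaConjR (d : ℕ) : ℝ := if d % 4 = 1 then (1 - Real.sqrt d) / 2 else -Real.sqrt d

/-- `F = ℚ(√d)`, realized as an intermediate field of `ℝ/ℚ` via the embedding with `√d > 0`. -/
def Fd (d : ℕ) : IntermediateField ℚ ℝ := IntermediateField.adjoin ℚ {Real.sqrt d}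

/-- The ring of integers `𝒪_F` of `F = ℚ(√d)`. -/
abbrev Od (d : ℕ) := NumberField.RingOfIntegers (Fd d)

/-- An element of `F` is totally positive if its image under each of the
(two) real embeddings of `F` is positive. -/
def TotPos {d : ℕ} (x : Fd d) : Prop := ∀ σ : Fd d →ₐ[ℚ] ℝ, 0 < σ x

/-- The conjugate `x̄` of `x ∈ F = ℚ(√d)`, as a real number: `x̄ = tr(x) - x`. -/
def conjR {d : ℕ} (x : Fd d) : ℝ := ((Algebra.trace ℚ (Fd d) x : ℚ) : ℝ) - (x : ℝ)

/-- A (not necessarily classic) quadratic `𝒪_F`-lattice: a finitely generated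
`𝒪_F`-module `L` with a quadratic map `Q : L → 𝒪_F` whose associated form
`B(x,y) = (Q(x+y)-Q(x)-Q(y))/2` (with values a priori in `F`) is symmetric
bilinear and satisfies `B(x,x) = Q(x)`. -/
structure QuadLattice (d : ℕ) where
  carrier : Type
  [isAddCommGroup : AddCommGroup carrier]
  [isModule : Module (Od d) carrier]
  finite : Module.Finite (Od d) carrier
  Q : carrier → Od d
  B : carrier → carrier → Fd d
  B_symm : ∀ x y, B x y = B y x
  B_add_left : ∀ x y z, B (x + y) z = B x z + B y z
  B_smul_left : ∀ (a : Od d) (x y : carrier), B (a • x) y = (a : Fd d) * B x y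
  B_self : ∀ x, B x x = (Q x : Fd d)
  B_def : ∀ x y, 2 * B x y = (Q (x + y) : Fd d) - (Q x : Fd d) - (Q y : Fd d)

attribute [instance] QuadLattice.isAddCommGroup QuadLattice.isModule

namespace QuadLattice

variable {d : ℕ} (L : QuadLattice d)

/-- `L` is classic if the bilinear form takes values in `𝒪_F`. -/
def IsClassic : Prop := ∀ x y, L.B x y ∈ integralClosure ℤ (Fd d)

/-- `L` is positive definite if `Q(x)` is totally positive for all `x ≠ 0`. -/
def PosDef : Prop := ∀ x : L.carrier, x ≠ 0 → TotPos (L.Q x : Fd d)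

/-- `L` is universal if `Q(L) = 𝒪_F⁺ ∪ {0}`. -/
def Universal : Prop :=
  (Set.range fun v => L.Q v) = {a : Od d | TotPos (a : Fd d)} ∪ {0}

end QuadLattice

/-- Replacing the factors of a product one at a time. -/
theorem abs_prod_sub_prod_le {ι : Type*} (t : Finset ι) (x y : ι → ℝ) {M δ : ℝ} (hM : 1 ≤ M)
    (hx : ∀ i ∈ t, |x i| ≤ M) (hy : ∀ i ∈ t, |y i| ≤ M) (hxy : ∀ i ∈ t, |x i - y i| ≤ δ) :
    |∏ i ∈ t, x i - ∏ i ∈ t, y i| ≤ t.card * (M ^ t.card * δ) := by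
  classical
  induction t using Finset.induction_on with
  | empty => simp
  | insert a t ha ih =>
    rw [Finset.prod_insert ha, Finset.prod_insert ha, Finset.card_insert_of_notMem ha]
    have hδ : 0 ≤ δ := (abs_nonneg _).trans (hxy a (Finset.mem_insert_self a t))
    have h := ih (fun i hi => hx i (Finset.mem_insert_of_mem hi))
      (fun i hi => hy i (Finset.mem_insert_of_mem hi))
      (fun i hi => hxy i (Finset.mem_insert_of_mem hi))
    have hpow : |∏ i ∈ t, y i| ≤ M ^ t.card := by
      rw [Finset.abs_prod]
      exact (Finset.prod_le_prod (fun i _ => abs_nonneg _)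
        fun i hi => hy i (Finset.mem_insert_of_mem hi)).trans_eq (Finset.prod_const M)
    have hM' : M ^ t.card ≤ M ^ (t.card + 1) := pow_le_pow_right₀ hM (Nat.le_succ _)
    calc |x a * ∏ i ∈ t, x i - y a * ∏ i ∈ t, y i|
        = |x a * (∏ i ∈ t, x i - ∏ i ∈ t, y i) + (x a - y a) * ∏ i ∈ t, y i| := by
          congr 1; ring
      _ ≤ |x a| * |∏ i ∈ t, x i - ∏ i ∈ t, y i| + |x a - y a| * |∏ i ∈ t, y i| := by
          rw [← abs_mul, ← abs_mul]; exact abs_add_le _ _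
      _ ≤ M * (t.card * (M ^ t.card * δ)) + δ * M ^ (t.card + 1) := by
          gcongr
          · exact hx a (Finset.mem_insert_self a t)
          · exact hxy a (Finset.mem_insert_self a t)
          · exact hpow.trans hM'
      _ = ((t.card + 1 : ℕ) : ℝ) * (M ^ (t.card + 1) * δ) := by push_cast; ring

theorem abs_det_sub_det_le {n : ℕ} (X Y : Matrix (Fin n) (Fin n) ℝ) {M δ : ℝ} (hM : 1 ≤ M)
    (hX : ∀ i j, |X i j| ≤ M) (hY : ∀ i j, |Y i j| ≤ M) (hXY : ∀ i j, |X i j - Y i j| ≤ δ) :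
    |X.det - Y.det| ≤ n.factorial * (n * (M ^ n * δ)) := by
  rw [Matrix.det_apply', Matrix.det_apply', ← Finset.sum_sub_distrib]
  refine (Finset.abs_sum_le_sum_abs _ _).trans ?_
  have h : ∀ σ ∈ (Finset.univ : Finset (Equiv.Perm (Fin n))),
      |((Equiv.Perm.sign σ : ℤ) : ℝ) * ∏ i, X (σ i) i - ((Equiv.Perm.sign σ : ℤ) : ℝ) *
        ∏ i, Y (σ i) i| ≤ n * (M ^ n * δ) := by
    intro σ _
    rw [← mul_sub, abs_mul, ← Int.cast_abs, Int.isUnit_iff_abs_eq.1 (Units.isUnit _)]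
    simpa using abs_prod_sub_prod_le Finset.univ (fun i => X (σ i) i) (fun i => Y (σ i) i) hM
      (fun i _ => hX _ _) (fun i _ => hY _ _) (fun i _ => hXY _ _)
  refine (Finset.sum_le_sum h).trans ?_
  simp [Fintype.card_perm]

/-- If `s • A + C` is singular with `A` integral and `s` large, then `A` is singular. -/
theorem det_eq_zero_of_det_smul_add_eq_zero (A : Matrix (Fin 4) (Fin 4) ℤ)
    (C : Matrix (Fin 4) (Fin 4) ℝ) {s : ℝ} (hs : 10 ^ 8 < s) (hA : ∀ i j, |A i j| ≤ 15)
    (hC : ∀ i j, |C i j| ≤ 1) (hdet : (s • A.map (Int.cast : ℤ → ℝ) + C).det = 0) :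
    A.det = 0 := by
  have hs0 : 0 < s := by linarith
  have hA' : ∀ i j, |(A i j : ℝ)| ≤ 15 := fun i j => by exact_mod_cast hA i j
  have hCs : ∀ i j, |s⁻¹ * C i j| ≤ 1 / 10 ^ 8 := fun i j => by
    rw [abs_mul, abs_of_pos (inv_pos.2 hs0)]
    calc s⁻¹ * |C i j| ≤ (10 ^ 8)⁻¹ * 1 := by gcongr; exact hC i j
      _ = 1 / 10 ^ 8 := by norm_num
  have hsing : (A.map (Int.cast : ℤ → ℝ) + s⁻¹ • C).det = 0 := by
    have : A.map (Int.cast : ℤ → ℝ) + s⁻¹ • C = s⁻¹ • (s • A.map (Int.cast : ℤ → ℝ) + C) := by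
      rw [smul_add, smul_smul, inv_mul_cancel₀ hs0.ne', one_smul]
    rw [this, Matrix.det_smul, hdet, mul_zero]
  have h := abs_det_sub_det_le (A.map (Int.cast : ℤ → ℝ)) (A.map (Int.cast : ℤ → ℝ) + s⁻¹ • C)
    (M := 16) (δ := 1 / 10 ^ 8) (by norm_num)
    (fun i j => (hA' i j).trans (by norm_num))
    (fun i j => by
      have := abs_add_le (A i j : ℝ) (s⁻¹ * C i j)
      have := hA' i j
      have := hCs i j
      norm_num at *
      linarith)
    (fun i j => by simpa using hCs i j)
  have hcast : (A.map (Int.cast : ℤ → ℝ)).det = (A.det : ℝ) :=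
    ((Int.castRingHom ℝ).map_det A).symm
  rw [hsing, sub_zero, hcast] at h
  have h1 : |(A.det : ℝ)| < 1 := h.trans_lt (by norm_num [Nat.factorial])
  have h2 : |A.det| < 1 := by exact_mod_cast h1
  exact Int.abs_lt_one_iff.1 h2

theorem det_symm_fin_four (p q r t e a c x y z : ℤ) :
    !![p, e, a, x; e, q, c, y; a, c, r, z; x, y, z, t].det =
      p * q * r * t - p * q * z ^ 2 - p * r * y ^ 2 - p * t * c ^ 2 - q * r * x ^ 2 - q * t * a ^ 2
        - r * t * e ^ 2 + e ^ 2 * z ^ 2 + a ^ 2 * y ^ 2 + c ^ 2 * x ^ 2 + 2 * p * c * y * z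
        + 2 * q * a * x * z + 2 * r * e * x * y + 2 * t * e * a * c - 2 * e * a * y * z
        - 2 * e * c * x * z - 2 * a * c * x * y := by
  rw [Matrix.det_succ_row_zero]
  simp [Fin.sum_univ_succ, Matrix.det_fin_three, Fin.succAbove]
  ring

/-- A singular quaternary Gram matrix containing `⟨1⟩ ⊥ ⟨1⟩` on `e₁, e₂ - e * e₁`. -/
theorem exists_repr_of_leading_one_one {e a c t x y z : ℤ} (he : e = 1 ∨ e = -1)
    (h : !![1, e, a, x; e, 2, c, y; a, c, 3, z; x, y, z, t].det = 0) :
    ∃ y' z' : ℤ, (3 - a ^ 2 - (c - e * a) ^ 2) * (t - x ^ 2 - y' ^ 2) = z' ^ 2 := by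
  rw [det_symm_fin_four] at h
  refine ⟨y - e * x, z - a * x - (c - e * a) * (y - e * x), ?_⟩
  rcases he with rfl | rfl <;> linear_combination h

/-- A singular quaternary Gram matrix containing `⟨1⟩ ⊥ ⟨2⟩`. -/
theorem exists_repr_of_leading_one_two {a k c t x y z : ℤ}
    (h : !![1, 0, a, x; 0, 2, 2 * k + c, y; a, 2 * k + c, 5, z; x, y, z, t].det = 0) :
    ∃ z' : ℤ, (2 * (5 - a ^ 2 - 2 * k ^ 2 - 2 * k * c) - c ^ 2) * (t - x ^ 2) =
      (5 - a ^ 2 - 2 * k ^ 2 - 2 * k * c) * y ^ 2 - 2 * c * y * z' + 2 * z' ^ 2 := by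
  rw [det_symm_fin_four] at h
  refine ⟨z - a * x - k * y, ?_⟩
  linear_combination h

/-- A positive diagonal ternary form over `ℤ` represents `m` only with small coordinates. -/
theorem diagonal_ne_of_forall_lt {α β γ m : ℕ} (b : ℕ)
    (hb : m < α * b ^ 2 ∧ m < β * b ^ 2 ∧ m < γ * b ^ 2)
    (h : ∀ x < b, ∀ y < b, ∀ z < b, α * x ^ 2 + β * y ^ 2 + γ * z ^ 2 ≠ m) (x y z : ℤ) :
    (α : ℤ) * x ^ 2 + β * y ^ 2 + γ * z ^ 2 ≠ m := by
  intro heq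
  have hN : α * x.natAbs ^ 2 + β * y.natAbs ^ 2 + γ * z.natAbs ^ 2 = m := by
    zify
    simpa only [sq_abs] using heq
  have bound : ∀ {δ w : ℕ}, δ * w ^ 2 ≤ m → m < δ * b ^ 2 → w < b := fun h1 h2 =>
    lt_of_pow_lt_pow_left₀ 2 (Nat.zero_le _)
      (lt_of_mul_lt_mul_left (h1.trans_lt h2) (Nat.zero_le _))
  exact h _ (bound (by omega) hb.1) _ (bound (by omega) hb.2.1) _ (bound (by omega) hb.2.2) hN

theorem no_repr_one_one {a u x x' x'' y y' y'' z z' z'' : ℤ} (h : 0 ≤ 3 - a ^ 2 - u ^ 2)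
    (h6 : (3 - a ^ 2 - u ^ 2) * (6 - x ^ 2 - y ^ 2) = z ^ 2)
    (h7 : (3 - a ^ 2 - u ^ 2) * (7 - x' ^ 2 - y' ^ 2) = z' ^ 2)
    (h14 : (3 - a ^ 2 - u ^ 2) * (14 - x'' ^ 2 - y'' ^ 2) = z'' ^ 2) : False := by
  obtain ⟨_, _⟩ : -1 ≤ a ∧ a ≤ 1 := by constructor <;> nlinarith [sq_nonneg u]
  obtain ⟨_, _⟩ : -1 ≤ u ∧ u ≤ 1 := by constructor <;> nlinarith [sq_nonneg a]
  have hn : 3 - a ^ 2 - u ^ 2 = 1 ∨ 3 - a ^ 2 - u ^ 2 = 2 ∨ 3 - a ^ 2 - u ^ 2 = 3 := by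
    interval_cases a <;> interval_cases u <;> norm_num
  rcases hn with hn | hn | hn
  · rw [hn] at h7
    exact diagonal_ne_of_forall_lt (α := 1) (β := 1) (γ := 1) (m := 7) 3 (by decide)
      (by decide +kernel) x' y' z' (by push_cast; linarith)
  · rw [hn] at h14
    exact diagonal_ne_of_forall_lt (α := 2) (β := 2) (γ := 1) (m := 28) 6 (by decide)
      (by decide +kernel) x'' y'' z'' (by push_cast; linarith)
  · rw [hn] at h6
    exact diagonal_ne_of_forall_lt (α := 3) (β := 3) (γ := 1) (m := 18) 5 (by decide)
      (by decide +kernel) x y z (by push_cast; linarith)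

theorem no_repr_one_two_diagonal {a k x x' x'' y y' y'' z z' z'' : ℤ}
    (h : 0 ≤ 5 - a ^ 2 - 2 * k ^ 2)
    (h7 : 2 * (5 - a ^ 2 - 2 * k ^ 2) * (7 - x ^ 2) =
      (5 - a ^ 2 - 2 * k ^ 2) * y ^ 2 + 2 * z ^ 2)
    (h10 : 2 * (5 - a ^ 2 - 2 * k ^ 2) * (10 - x' ^ 2) =
      (5 - a ^ 2 - 2 * k ^ 2) * y' ^ 2 + 2 * z' ^ 2)
    (h14 : 2 * (5 - a ^ 2 - 2 * k ^ 2) * (14 - x'' ^ 2) =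
      (5 - a ^ 2 - 2 * k ^ 2) * y'' ^ 2 + 2 * z'' ^ 2) : False := by
  obtain ⟨_, _⟩ : -2 ≤ a ∧ a ≤ 2 := by constructor <;> nlinarith [sq_nonneg k]
  obtain ⟨_, _⟩ : -1 ≤ k ∧ k ≤ 1 := by constructor <;> nlinarith [sq_nonneg a]
  have hn : 5 - a ^ 2 - 2 * k ^ 2 = 1 ∨ 5 - a ^ 2 - 2 * k ^ 2 = 2 ∨ 5 - a ^ 2 - 2 * k ^ 2 = 3 ∨
      5 - a ^ 2 - 2 * k ^ 2 = 4 ∨ 5 - a ^ 2 - 2 * k ^ 2 = 5 := by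
    interval_cases a <;> interval_cases k <;> norm_num at *
  rcases hn with hn | hn | hn | hn | hn
  · rw [hn] at h14
    exact diagonal_ne_of_forall_lt (α := 2) (β := 1) (γ := 2) (m := 28) 6 (by decide)
      (by decide +kernel) x'' y'' z'' (by push_cast; linarith)
  · rw [hn] at h7
    exact diagonal_ne_of_forall_lt (α := 4) (β := 2) (γ := 2) (m := 28) 4 (by decide)
      (by decide +kernel) x y z (by push_cast; linarith)
  · rw [hn] at h10
    exact diagonal_ne_of_forall_lt (α := 6) (β := 3) (γ := 2) (m := 60) 6 (by decide)
      (by decide +kernel) x' y' z' (by push_cast; linarith)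
  · rw [hn] at h14
    exact diagonal_ne_of_forall_lt (α := 8) (β := 4) (γ := 2) (m := 112) 8 (by decide)
      (by decide +kernel) x'' y'' z'' (by push_cast; linarith)
  · rw [hn] at h10
    exact diagonal_ne_of_forall_lt (α := 10) (β := 5) (γ := 2) (m := 100) 8 (by decide)
      (by decide +kernel) x' y' z' (by push_cast; linarith)

theorem no_repr_one_two_nondiagonal {a k x y z : ℤ}
    (h : 0 ≤ 2 * (5 - a ^ 2 - 2 * k ^ 2 - 2 * k) - 1)
    (h7 : (2 * (5 - a ^ 2 - 2 * k ^ 2 - 2 * k) - 1) * (7 - x ^ 2) =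
      (5 - a ^ 2 - 2 * k ^ 2 - 2 * k) * y ^ 2 - 2 * y * z + 2 * z ^ 2) : False := by
  obtain ⟨_, _⟩ : -2 ≤ a ∧ a ≤ 2 := by constructor <;> nlinarith [sq_nonneg (2 * k + 1)]
  obtain ⟨_, _⟩ : -2 ≤ k ∧ k ≤ 1 := by constructor <;> nlinarith [sq_nonneg a]
  have hn : 5 - a ^ 2 - 2 * k ^ 2 - 2 * k = 1 ∨ 5 - a ^ 2 - 2 * k ^ 2 - 2 * k = 4 ∨
      5 - a ^ 2 - 2 * k ^ 2 - 2 * k = 5 := by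
    interval_cases a <;> interval_cases k <;> norm_num at *
  rcases hn with hn | hn | hn <;> rw [hn] at h7
  · exact diagonal_ne_of_forall_lt (α := 2) (β := 1) (γ := 1) (m := 14) 4 (by decide)
      (by decide +kernel) x y (2 * z - y) (by push_cast; linarith)
  · exact diagonal_ne_of_forall_lt (α := 14) (β := 7) (γ := 1) (m := 98) 10 (by decide)
      (by decide +kernel) x y (2 * z - y) (by push_cast; linarith)
  · exact diagonal_ne_of_forall_lt (α := 18) (β := 9) (γ := 1) (m := 126) 12 (by decide)
      (by decide +kernel) x y (2 * z - y) (by push_cast; linarith)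

/-- An integral positive semidefinite form on `ℤ¹⁵` taking the values `1, …, 15` on the standard
basis has a nonzero quaternary principal minor. -/
theorem exists_minor_ne_zero (H : Fin 15 → Fin 15 → ℤ) (hsymm : ∀ i j, H i j = H j i)
    (hdiag : ∀ i : Fin 15, H i i = (i : ℕ) + 1)
    (hpos : ∀ (i j k : Fin 15) (x y z : ℤ), |x| ≤ 100 → |y| ≤ 100 → |z| ≤ 100 →
      0 ≤ x ^ 2 * H i i + y ^ 2 * H j j + z ^ 2 * H k k + 2 * x * y * H i j + 2 * x * z * H i k
        + 2 * y * z * H j k) :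
    ∃ f : Fin 4 → Fin 15, (Matrix.of fun a b => H (f a) (f b)).det ≠ 0 := by
  by_contra! hdet
  have hbd : ∀ i j, 2 * |H i j| ≤ (i : ℕ) + 1 + ((j : ℕ) + 1) := by
    intro i j
    have h1 := hpos i j i 1 1 0 (by norm_num) (by norm_num) (by norm_num)
    have h2 := hpos i j i 1 (-1) 0 (by norm_num) (by norm_num) (by norm_num)
    have := hdiag i
    have := hdiag j
    rcases abs_cases (H i j) with h | h <;> linarith
  have hgram : ∀ i j k l, !![H i i, H i j, H i k, H i l; H i j, H j j, H j k, H j l;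
      H i k, H j k, H k k, H k l; H i l, H j l, H k l, H l l].det = 0 := by
    intro i j k l
    rw [← hdet ![i, j, k, l]]
    congr 1
    ext a b
    fin_cases a <;> fin_cases b <;> simp [hsymm]
  have d0 : H 0 0 = 1 := by simpa using hdiag 0
  have d1 : H 1 1 = 2 := by simpa using hdiag 1
  have d2 : H 2 2 = 3 := by simpa using hdiag 2
  have d4 : H 4 4 = 5 := by simpa using hdiag 4
  have d5 : H 5 5 = 6 := by simpa using hdiag 5
  have d6 : H 6 6 = 7 := by simpa using hdiag 6
  have d9 : H 9 9 = 10 := by simpa using hdiag 9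
  have d13 : H 13 13 = 14 := by simpa using hdiag 13
  by_cases he : H 0 1 = 0
  · obtain ⟨k, r, hr, hc⟩ : ∃ k r : ℤ, (r = 0 ∨ r = 1) ∧ H 1 4 = 2 * k + r :=
      ⟨H 1 4 / 2, H 1 4 % 2, by omega, by omega⟩
    have key := fun l => exists_repr_of_leading_one_two
      (by simpa only [d0, d1, d4, he, hc] using hgram 0 1 4 l)
    have h04 := hbd 0 4
    have h14 := hbd 1 4
    have hp := hpos 0 1 4 (-(2 * H 0 4)) (-(H 1 4)) 2
    simp only [d0, d1, d4, he, Fin.isValue, Fin.coe_ofNat_eq_mod] at h04 h14 hp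
    replace hp := hp (by grind) (by grind) (by norm_num)
    rw [hc] at hp
    have key6 := key 6
    have key9 := key 9
    have key13 := key 13
    simp only [d6, d9, d13] at key6 key9 key13
    generalize H 0 4 = a at *
    obtain ⟨z₁, h7⟩ := key6
    obtain ⟨z₂, h10⟩ := key9
    obtain ⟨z₃, h14⟩ := key13
    rcases hr with rfl | rfl
    · simp only [mul_zero, zero_mul, sub_zero, ne_eq, OfNat.ofNat_ne_zero, not_false_eq_true,
        zero_pow] at h7 h10 h14
      exact no_repr_one_two_diagonal (by linarith) h7 h10 h14
    · simp only [mul_one, one_pow] at h7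
      exact no_repr_one_two_nondiagonal (by linarith) h7
  · have he' : H 0 1 = 1 ∨ H 0 1 = -1 := by
      have h01 := hbd 0 1
      simp at h01
      rcases abs_cases (H 0 1) with h | h <;> omega
    have key := fun l => exists_repr_of_leading_one_one he'
      (by simpa only [d0, d1, d2] using hgram 0 1 2 l)
    have h02 := hbd 0 2
    have h12 := hbd 1 2
    have hp := hpos 0 1 2 (-H 0 2 + H 0 1 * (H 1 2 - H 0 1 * H 0 2)) (-(H 1 2 - H 0 1 * H 0 2)) 1
    have key5 := key 5
    have key6 := key 6
    have key13 := key 13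
    simp only [d0, d1, d2, d5, d6, d13, Fin.isValue, Fin.coe_ofNat_eq_mod] at *
    generalize H 0 1 = e at *
    generalize H 0 2 = a at *
    generalize H 1 2 = c at *
    obtain ⟨u, hu⟩ : ∃ u, u = c - e * a := ⟨_, rfl⟩
    rw [← hu] at hp key5 key6 key13
    obtain ⟨y₁, z₁, h6⟩ := key5
    obtain ⟨y₂, z₂, h7⟩ := key6
    obtain ⟨y₃, z₃, h14⟩ := key13
    refine no_repr_one_one ?_ h6 h7 h14
    have hp' := hp (by rcases he' with rfl | rfl <;> grind)
      (by grind) (by norm_num)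
    obtain rfl : c = u + e * a := by linarith
    rcases he' with rfl | rfl <;> linarith
/-- A large real multiple of an integral Gram matrix plus a bounded positive semidefinite one:
if all values are nonnegative and the integral part takes the values `1, …, 15` on the diagonal,
then some quaternary minor is nonzero. -/
theorem exists_gram_minor_ne_zero {s : ℝ} (hs : 10 ^ 8 < s) (H : Fin 15 → Fin 15 → ℤ)
    (C : Fin 15 → Fin 15 → ℝ) (hsymm : ∀ i j, H i j = H j i)
    (hdiag : ∀ i : Fin 15, H i i = (i : ℕ) + 1) (hC1 : ∀ i, C i i ≤ 1)
    (hC : ∀ (i j k : Fin 15) (x y z : ℤ),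
      0 ≤ (x : ℝ) ^ 2 * C i i + y ^ 2 * C j j + z ^ 2 * C k k + 2 * x * y * C i j
        + 2 * x * z * C i k + 2 * y * z * C j k)
    (hG : ∀ (i j k : Fin 15) (x y z : ℤ),
      0 ≤ (x : ℝ) ^ 2 * (s * H i i + C i i) + y ^ 2 * (s * H j j + C j j)
        + z ^ 2 * (s * H k k + C k k) + 2 * x * y * (s * H i j + C i j)
        + 2 * x * z * (s * H i k + C i k) + 2 * y * z * (s * H j k + C j k)) :
    ∃ f : Fin 4 → Fin 15,
      (Matrix.of fun a b => s * (H (f a) (f b) : ℝ) + C (f a) (f b)).det ≠ 0 := by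
  have hCabs : ∀ i j, |C i j| ≤ 1 := by
    intro i j
    have h1 := hC i j i 1 1 0
    have h2 := hC i j i 1 (-1) 0
    push_cast at h1 h2
    exact abs_le.2 ⟨by linarith [hC1 i, hC1 j], by linarith [hC1 i, hC1 j]⟩
  have hterm : ∀ (i j : Fin 15) (x y : ℤ), |x| ≤ 100 → |y| ≤ 100 → x * y * C i j ≤ 10 ^ 4 := by
    intro i j x y hx hy
    have hx' : |(x : ℝ)| ≤ 100 := by exact_mod_cast hx
    have hy' : |(y : ℝ)| ≤ 100 := by exact_mod_cast hy
    calc x * y * C i j ≤ |x * y * C i j| := le_abs_self _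
      _ = |(x : ℝ)| * |(y : ℝ)| * |C i j| := by rw [abs_mul, abs_mul]
      _ ≤ 100 * 100 * 1 := by gcongr; exact hCabs i j
      _ = 10 ^ 4 := by norm_num
  have hpos : ∀ (i j k : Fin 15) (x y z : ℤ), |x| ≤ 100 → |y| ≤ 100 → |z| ≤ 100 →
      0 ≤ x ^ 2 * H i i + y ^ 2 * H j j + z ^ 2 * H k k + 2 * x * y * H i j + 2 * x * z * H i k
        + 2 * y * z * H j k := by
    intro i j k x y z hx hy hz
    set N := x ^ 2 * H i i + y ^ 2 * H j j + z ^ 2 * H k k + 2 * x * y * H i j + 2 * x * z * H i k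
        + 2 * y * z * H j k with hN
    have hNs : -(9 * 10 ^ 4) ≤ s * (N : ℝ) := by
      rw [hN]
      push_cast
      linarith [hG i j k x y z, hterm i i x x hx hx, hterm j j y y hy hy, hterm k k z z hz hz,
        hterm i j x y hx hy, hterm i k x z hx hz, hterm j k y z hy hz]
    by_contra! hneg
    have : (N : ℝ) ≤ -1 := by exact_mod_cast Int.le_sub_one_of_lt hneg
    nlinarith
  obtain ⟨f, hf⟩ := exists_minor_ne_zero H hsymm hdiag hpos
  refine ⟨f, fun h0 => hf ?_⟩
  refine det_eq_zero_of_det_smul_add_eq_zero _ (Matrix.of fun a b => C (f a) (f b)) hs ?_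
    (fun _ _ => hCabs _ _) ?_
  · intro a b
    have h1 := hpos (f a) (f b) (f a) 1 1 0 (by norm_num) (by norm_num) (by norm_num)
    have h2 := hpos (f a) (f b) (f a) 1 (-1) 0 (by norm_num) (by norm_num) (by norm_num)
    have := hdiag (f a)
    have := hdiag (f b)
    have := (f a).isLt
    have := (f b).isLt
    exact abs_le.2 ⟨by simp only [Matrix.of_apply]; omega, by simp only [Matrix.of_apply]; omega⟩
  · rw [← h0]
    congr 1

section QuadraticField

variable {d : ℕ}

theorem not_isSquare_natCast (hd : Squarefree d) (hd1 : 1 < d) : ¬ IsSquare (d : ℚ) := by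
  rw [Rat.isSquare_natCast_iff]
  rintro ⟨a, rfl⟩
  have := Nat.isUnit_iff.1 (hd a dvd_rfl)
  simp [this] at hd1

/-- `√d` as an element of `ℚ(√d)`. -/
def sqrtGen (d : ℕ) : Fd d :=
  ⟨Real.sqrt d, IntermediateField.mem_adjoin_simple_self ℚ (Real.sqrt d)⟩

theorem coe_sqrtGen : (sqrtGen d : ℝ) = Real.sqrt d := rfl

theorem minpoly_sqrt (hd : Squarefree d) (hd1 : 1 < d) :
    minpoly ℚ (Real.sqrt d) = Polynomial.X ^ 2 - Polynomial.C (d : ℚ) :=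
  (minpoly.eq_of_irreducible_of_monic
    (X_pow_sub_C_irreducible_of_prime Nat.prime_two
      fun b hb => not_isSquare_natCast hd hd1 ⟨b, by rw [← hb, sq]⟩)
    (by simp) (Polynomial.monic_X_pow_sub_C _ two_ne_zero)).symm

theorem isIntegral_sqrt : IsIntegral ℚ (Real.sqrt d) :=
  ⟨Polynomial.X ^ 2 - Polynomial.C (d : ℚ), Polynomial.monic_X_pow_sub_C _ two_ne_zero, by simp⟩

theorem exists_conj (hd : Squarefree d) (hd1 : 1 < d) :
    ∃ τ : Fd d →ₐ[ℚ] ℝ, τ (sqrtGen d) = -Real.sqrt d := by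
  refine ⟨(IntermediateField.algHomAdjoinIntegralEquiv ℚ isIntegral_sqrt).symm
    ⟨-Real.sqrt d, ?_⟩, IntermediateField.algHomAdjoinIntegralEquiv_symm_apply_gen ℚ _ _⟩
  rw [Polynomial.mem_aroots, minpoly_sqrt hd hd1]
  exact ⟨Polynomial.X_pow_sub_C_ne_zero two_pos _, by simp⟩

theorem exists_eq_add_mul_sqrtGen (x : Fd d) :
    ∃ p q : ℚ, x = algebraMap ℚ (Fd d) p + algebraMap ℚ (Fd d) q * sqrtGen d := by
  have key : ∀ x ∈ Algebra.adjoin ℚ {Real.sqrt d}, ∃ p q : ℚ, x = p + q * Real.sqrt d := by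
    intro x hx
    induction hx using Algebra.adjoin_induction with
    | mem x hx => exact ⟨0, 1, by simpa using hx⟩
    | algebraMap r => exact ⟨r, 0, by simp⟩
    | add x y _ _ hx hy =>
      obtain ⟨p, q, rfl⟩ := hx
      obtain ⟨p', q', rfl⟩ := hy
      exact ⟨p + p', q + q', by push_cast; ring⟩
    | mul x y _ _ hx hy =>
      obtain ⟨p, q, rfl⟩ := hx
      obtain ⟨p', q', rfl⟩ := hy
      refine ⟨p * p' + d * q * q', p * q' + p' * q, ?_⟩
      have := Real.mul_self_sqrt (Nat.cast_nonneg (α := ℝ) d)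
      push_cast
      linear_combination q * q' * this
  obtain ⟨p, q, h⟩ := key x (by
    rw [← IntermediateField.adjoin_simple_toSubalgebra_of_isAlgebraic isIntegral_sqrt.isAlgebraic]
    exact x.2)
  exact ⟨p, q, Subtype.ext (by simpa [coe_sqrtGen] using h)⟩

theorem exists_int_of_isIntegral {q : ℚ} (h : IsIntegral ℤ (q : ℝ)) : ∃ n : ℤ, (n : ℚ) = q := by
  have : IsIntegral ℤ q := (isIntegral_algebraMap_iff (algebraMap ℚ ℝ).injective).1 h
  simpa using IsIntegrallyClosed.isIntegral_iff.1 this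

/-- The square root of the discriminant. -/
theorem omegaR_sub_omegaConjR (d : ℕ) : omegaR d - omegaConjR d = Real.sqrt (Delta d) := by
  unfold omegaR omegaConjR Delta
  split_ifs
  · ring
  · have : Real.sqrt 4 = 2 := by
      rw [show (4 : ℝ) = 2 ^ 2 by norm_num]; exact Real.sqrt_sq (by norm_num)
    push_cast
    rw [Real.sqrt_mul (by norm_num), this]
    ring

/-- A rational number whose square becomes integral after multiplication by a squarefree
number is an integer. -/
theorem exists_int_of_squarefree_mul_sq (hd : Squarefree d) {w : ℚ} {N : ℤ}
    (h : (d : ℚ) * w ^ 2 = N) : ∃ u : ℤ, (u : ℚ) = w := by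
  have hden : (w.den : ℚ) ≠ 0 := by exact_mod_cast w.den_nz
  have h1 : (d : ℤ) * w.num ^ 2 = N * (w.den : ℤ) ^ 2 := by
    rw [← Rat.num_div_den w, div_pow, mul_div_assoc', div_eq_iff (pow_ne_zero 2 hden)] at h
    exact_mod_cast h
  have h2 : w.den ^ 2 ∣ d * w.num.natAbs ^ 2 :=
    ⟨N.natAbs, by simpa [Int.natAbs_mul, Int.natAbs_pow, mul_comm] using congrArg Int.natAbs h1⟩
  have h3 : w.den ^ 2 ∣ d := (w.reduced.symm.pow 2 2).dvd_of_dvd_mul_right h2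
  have h4 : w.den = 1 := Nat.isUnit_iff.1 (hd w.den (by rwa [← sq]))
  exact ⟨w.num, Rat.coe_int_num_of_den_eq_one h4⟩

theorem exists_sub_conj_eq (hd : Squarefree d) (τ : Fd d →ₐ[ℚ] ℝ)
    (hτ : τ (sqrtGen d) = -Real.sqrt d) (x : Fd d) (hx : IsIntegral ℤ x) :
    ∃ n : ℤ, (x : ℝ) - τ x = Real.sqrt (Delta d) * n := by
  obtain ⟨p, q, rfl⟩ := exists_eq_add_mul_sqrtGen x
  have hι : ((algebraMap ℚ (Fd d) p + algebraMap ℚ (Fd d) q * sqrtGen d : Fd d) : ℝ) =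
      p + q * Real.sqrt d := by simp [coe_sqrtGen]
  have hτ' : τ (algebraMap ℚ (Fd d) p + algebraMap ℚ (Fd d) q * sqrtGen d) =
      p - q * Real.sqrt d := by
    rw [map_add, map_mul, AlgHom.commutes, AlgHom.commutes, hτ]
    simp [sub_eq_add_neg]
  have h1 : IsIntegral ℤ ((p : ℝ) + q * Real.sqrt d) :=
    hι ▸ hx.map ((Fd d).val.restrictScalars ℤ)
  have h2 : IsIntegral ℤ ((p : ℝ) - q * Real.sqrt d) := hτ' ▸ hx.map (τ.restrictScalars ℤ)
  have hsq : Real.sqrt d * Real.sqrt d = d := Real.mul_self_sqrt (Nat.cast_nonneg d)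
  obtain ⟨t, ht⟩ : ∃ t : ℤ, (t : ℚ) = 2 * p := by
    apply exists_int_of_isIntegral
    have h : ((2 * p : ℚ) : ℝ) = p + q * Real.sqrt d + (p - q * Real.sqrt d) := by push_cast; ring
    exact h ▸ h1.add h2
  obtain ⟨m, hm⟩ : ∃ m : ℤ, (m : ℚ) = p ^ 2 - d * q ^ 2 := by
    apply exists_int_of_isIntegral
    have h : ((p ^ 2 - d * q ^ 2 : ℚ) : ℝ) =
        (p + q * Real.sqrt d) * (p - q * Real.sqrt d) := by
      push_cast; linear_combination (q : ℝ) ^ 2 * hsq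
    exact h ▸ h1.mul h2
  obtain ⟨u, hu⟩ : ∃ u : ℤ, (u : ℚ) = 2 * q :=
    exists_int_of_squarefree_mul_sq (N := t ^ 2 - 4 * m) hd (by push_cast; rw [ht, hm]; ring)
  have hrel : (d : ℤ) * u ^ 2 = t ^ 2 - 4 * m := by
    have : (d : ℚ) * u ^ 2 = t ^ 2 - 4 * m := by rw [hu, ht, hm]; ring
    exact_mod_cast this
  have huR : (u : ℝ) = 2 * q := by exact_mod_cast congrArg (Rat.cast : ℚ → ℝ) hu
  have hsub : (p + q * Real.sqrt d) - (p - q * Real.sqrt d) = Real.sqrt d * u := by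
    rw [huR]; ring
  rw [hι, hτ', hsub, ← omegaR_sub_omegaConjR]
  unfold omegaR omegaConjR
  split_ifs with h4
  · exact ⟨u, by ring⟩
  · have hd4 : d % 4 ≠ 0 := fun h => by
      have := Nat.isUnit_iff.1 (hd 2 (by omega))
      omega
    rcases Int.even_or_odd' u with ⟨w, rfl | rfl⟩
    · exact ⟨w, by push_cast; ring⟩
    · exfalso
      rcases Int.even_or_odd' t with ⟨r, rfl | rfl⟩
      · have : (d : ℤ) = 4 * (r ^ 2 - m - d * (w ^ 2 + w)) := by linear_combination hrel
        omega
      · have : (d : ℤ) = 4 * (r ^ 2 + r - m - d * (w ^ 2 + w)) + 1 := by linear_combination hrel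
        omega

/-- An element of `ℚ(√d)` lifting `ω_d` together with its conjugate. -/
theorem exists_omega (τ : Fd d →ₐ[ℚ] ℝ) (hτ : τ (sqrtGen d) = -Real.sqrt d) :
    ∃ w : Fd d, (w : ℝ) = omegaR d ∧ τ w = omegaConjR d := by
  unfold omegaR omegaConjR
  split_ifs
  · refine ⟨(1 + sqrtGen d) / 2, by simp [coe_sqrtGen]; rfl, ?_⟩
    rw [map_div₀, map_add, map_one, map_ofNat, hτ, sub_eq_add_neg]
  · exact ⟨sqrtGen d, coe_sqrtGen, hτ⟩

end QuadraticField

namespace QuadLattice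

variable {d : ℕ} (L : QuadLattice d)

theorem B_zero_left (y : L.carrier) : L.B 0 y = 0 := by
  simpa using L.B_smul_left 0 0 y

theorem B_sum_smul_left {ι : Type*} (t : Finset ι) (g : ι → Od d) (w : ι → L.carrier)
    (y : L.carrier) : L.B (∑ i ∈ t, g i • w i) y = ∑ i ∈ t, (g i : Fd d) * L.B (w i) y := by
  classical
  induction t using Finset.induction_on with
  | empty => simpa using L.B_zero_left y
  | insert a t ha ih =>
    rw [Finset.sum_insert ha, Finset.sum_insert ha, L.B_add_left, L.B_smul_left, ih]

theorem B_self_combination (u v w : L.carrier) (x y z : ℤ) :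
    L.B ((x : Od d) • u + (y : Od d) • v + (z : Od d) • w)
        ((x : Od d) • u + (y : Od d) • v + (z : Od d) • w) =
      (x : Fd d) ^ 2 * L.B u u + y ^ 2 * L.B v v + z ^ 2 * L.B w w + 2 * x * y * L.B u v
        + 2 * x * z * L.B u w + 2 * y * z * L.B v w := by
  have hcast : ∀ n : ℤ, (((n : Od d)) : Fd d) = n := fun n => map_intCast (algebraMap (Od d) _) n
  have hright : ∀ s : L.carrier, L.B s ((x : Od d) • u + (y : Od d) • v + (z : Od d) • w) =
      x * L.B s u + y * L.B s v + z * L.B s w := by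
    intro s
    rw [L.B_symm, L.B_add_left, L.B_add_left, L.B_smul_left, L.B_smul_left, L.B_smul_left,
      L.B_symm u, L.B_symm v, L.B_symm w, hcast, hcast, hcast]
  rw [L.B_add_left, L.B_add_left, L.B_smul_left, L.B_smul_left, L.B_smul_left, hright, hright,
    hright, L.B_symm v u, L.B_symm w u, L.B_symm w v,
    hcast, hcast, hcast]
  ring

variable {L}

theorem PosDef.nonneg (hpd : L.PosDef) (σ : Fd d →ₐ[ℚ] ℝ) (x : L.carrier) :
    0 ≤ σ (L.B x x) := by
  rcases eq_or_ne x 0 with rfl | hx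
  · rw [L.B_zero_left, map_zero]
  · rw [L.B_self]
    exact (hpd x hx σ).le

theorem PosDef.combination_nonneg (hpd : L.PosDef) (σ : Fd d →ₐ[ℚ] ℝ) (u v w : L.carrier)
    (x y z : ℤ) :
    0 ≤ (x : ℝ) ^ 2 * σ (L.B u u) + y ^ 2 * σ (L.B v v) + z ^ 2 * σ (L.B w w)
      + 2 * x * y * σ (L.B u v) + 2 * x * z * σ (L.B u w) + 2 * y * z * σ (L.B v w) := by
  have h := hpd.nonneg σ ((x : Od d) • u + (y : Od d) • v + (z : Od d) • w)
  rw [B_self_combination] at h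
  simpa only [map_add, map_mul, map_pow, map_intCast, map_ofNat] using h

/-- The Gram matrix of linearly dependent vectors is singular. -/
theorem det_gram_eq_zero {n : ℕ} {w : Fin n → L.carrier} (hw : ¬ LinearIndependent (Od d) w) :
    (Matrix.of fun a b => (L.B (w a) (w b) : ℝ)).det = 0 := by
  obtain ⟨g, hg, i, hi⟩ := Fintype.not_linearIndependent_iff.1 hw
  refine Matrix.exists_mulVec_eq_zero_iff.1 ⟨fun j => ((g j : Fd d) : ℝ), fun h => hi ?_, ?_⟩
  · have := congrFun h i
    simpa using this
  · funext a
    have h := L.B_sum_smul_left Finset.univ g w (w a)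
    rw [hg, L.B_zero_left] at h
    have h' := congrArg (fun x : Fd d => (x : ℝ)) h
    simp only [Matrix.mulVec, dotProduct, Matrix.of_apply, Pi.zero_apply]
    rw [ZeroMemClass.coe_zero, AddSubmonoidClass.coe_finsetSum] at h'
    rw [h']
    exact Finset.sum_congr rfl fun b _ => by rw [L.B_symm (w b), MulMemClass.coe_mul, mul_comm]

end QuadLattice

/-- **Lemma (Statement 12).** Let `Δ_d > (4·4!·4!·15⁴)²` and let `L` be a positive
definite classic universal quadratic `𝒪_F`-lattice. For `k = 1, …, 15` let
`v_k ∈ L` with `Q(v_k) = m_k + k·ω_d` where `m_k = -⌊k·ω̄_d⌋`, and let `L₂` be the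
`𝒪_F`-submodule of `L` generated by `v₁, …, v₁₅`. Then `rank(L₂) ≥ 4`. -/
theorem rank_span_ge_four
    (d : ℕ) (hd : Squarefree d) (hd1 : 1 < d)
    (hΔ : (4 * Nat.factorial 4 * Nat.factorial 4 * 15 ^ 4) ^ 2 < Delta d)
    (L : QuadLattice d) (hcl : L.IsClassic) (hpd : L.PosDef) (hun : L.Universal)
    (v : Fin 15 → L.carrier)
    (hv : ∀ k : Fin 15, ((L.Q (v k) : Fd d) : ℝ)
        = ((-⌊(((k : ℕ) + 1 : ℕ) : ℝ) * omegaConjR d⌋ : ℤ) : ℝ)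
            + (((k : ℕ) + 1 : ℕ) : ℝ) * omegaR d) :
    4 ≤ Module.rank (Od d) (Submodule.span (Od d) (Set.range v)) := by
  
  have hs : (10 : ℝ) ^ 8 < Real.sqrt (Delta d) := by
    apply Real.lt_sqrt_of_sq_lt
    have h : (10 ^ 8) ^ 2 < Delta d := lt_of_le_of_lt (by norm_num [Nat.factorial]) hΔ
    exact_mod_cast h
  obtain ⟨τ, hτ⟩ := exists_conj hd hd1
  obtain ⟨w, hw, hwτ⟩ := exists_omega τ hτ
  choose H hH using fun i j => exists_sub_conj_eq hd τ hτ (L.B (v i) (v j)) (hcl _ _)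
  have hG : ∀ i j, (L.B (v i) (v j) : ℝ) = Real.sqrt (Delta d) * H i j + τ (L.B (v i) (v j)) :=
    fun i j => by rw [← hH]; ring
  have hQ : ∀ k : Fin 15, L.B (v k) (v k)
      = ((-⌊(((k : ℕ) + 1 : ℕ) : ℝ) * omegaConjR d⌋ : ℤ) : Fd d)
        + (((k : ℕ) + 1 : ℕ) : Fd d) * w := by
    intro k
    rw [L.B_self]
    apply Subtype.ext
    rw [hv k, ← hw]
    push_cast
    rfl
  have hτQ : ∀ k : Fin 15,
      τ (L.B (v k) (v k)) = Int.fract ((((k : ℕ) + 1 : ℕ) : ℝ) * omegaConjR d) := by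
    intro k
    rw [hQ, map_add, map_mul, map_natCast, map_intCast, hwτ, Int.fract]
    push_cast
    ring
  obtain ⟨f, hf⟩ := exists_gram_minor_ne_zero hs H (fun i j => τ (L.B (v i) (v j)))
    (fun i j => by
      have h : Real.sqrt (Delta d) * (H i j : ℝ) = Real.sqrt (Delta d) * H j i := by
        rw [← hH, ← hH, L.B_symm]
      exact_mod_cast mul_left_cancel₀ (by positivity) h)
    (fun k => by
      have h : Real.sqrt (Delta d) * (H k k : ℝ) = Real.sqrt (Delta d) * ((k : ℕ) + 1) := by
        rw [← hH, hτQ, L.B_self, hv, ← omegaR_sub_omegaConjR, Int.fract]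
        push_cast
        ring
      exact_mod_cast mul_left_cancel₀ (by positivity) h)
    (fun k => by rw [hτQ]; exact (Int.fract_lt_one _).le)
    (fun i j k => hpd.combination_nonneg τ _ _ _)
    (fun i j k => by
      simp only [← hG]
      exact hpd.combination_nonneg (Fd d).val _ _ _)
  simp only [← hG] at hf
  have hli : LinearIndependent (Od d) (v ∘ f) := by
    by_contra h
    exact hf (QuadLattice.det_gram_eq_zero h)
  have hspan : LinearIndependent (Od d)
      (fun a => (⟨v (f a), Submodule.subset_span ⟨f a, rfl⟩⟩ :
        Submodule.span (Od d) (Set.range v))) :=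
    LinearIndependent.of_comp (Submodule.subtype _) hli
  simpa using hspan.cardinal_le_rank
end
end

section
/- Let d be a squarefree positive integer with discriminant Δ_d > (4·4!·4!·15⁴)², let F = ℚ(√d), and let L be a positive definite classic quadratic 𝒪_F-lattice. Suppose v, w ∈ L satisfy Q(v) = m_i + i·ω_d and Q(w) = m_j + j·ω_d for some integers 1 ≤ i, j ≤ 15, where m_k = −⌊k·ω̄_d⌋. Then B(v,w) = ±(−⌊a·ω̄_d⌋ + a·ω_d) for some a ∈ ℤ with |a| ≤ √(i·j) ≤ 15. -/
noncomputable section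

theorem Rat.exists_int_eq_of_squarefree_mul_sq {d : ℕ} (hd : Squarefree d) {r : ℚ} {n : ℤ}
    (h : (d : ℚ) * r ^ 2 = n) : ∃ t : ℤ, r = t := by
  have hden : (r.den : ℚ) ≠ 0 := by exact_mod_cast r.den_ne_zero
  have h1 : (d : ℚ) * r.num ^ 2 = n * r.den ^ 2 := by
    rw [← h]
    nth_rewrite 2 [← Rat.num_div_den r]
    field_simp
  have h2 : (d : ℤ) * r.num ^ 2 = n * (r.den : ℤ) ^ 2 := by exact_mod_cast h1
  have hcop : IsCoprime ((r.den : ℤ) ^ 2) (r.num ^ 2) := by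
    apply IsCoprime.pow
    rw [Int.isCoprime_iff_gcd_eq_one, Int.gcd_comm]
    exact r.reduced
  have hdvd : (r.den : ℤ) ^ 2 ∣ d := hcop.dvd_of_dvd_mul_right ⟨n, by rw [h2]; ring⟩
  have hdvd' : r.den * r.den ∣ d := by
    rw [← sq]
    exact_mod_cast hdvd
  have hone : r.den = 1 := Nat.isUnit_iff.1 (hd _ hdvd')
  exact ⟨r.num, (Rat.den_eq_one_iff r).1 hone |>.symm⟩

theorem not_isSquare_of_squarefree {d : ℕ} (hd : Squarefree d) (hd1 : 1 < d) : ¬ IsSquare d := by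
  rintro ⟨k, rfl⟩
  have := Nat.isUnit_iff.1 (hd k dvd_rfl)
  subst this
  omega

/-- The generator `√d` of `ℚ(√d)`. -/
def sqrtFd (d : ℕ) : Fd d := IntermediateField.AdjoinSimple.gen ℚ (Real.sqrt d)

theorem coe_sqrtFd (d : ℕ) : ((sqrtFd d : Fd d) : ℝ) = Real.sqrt d := rfl

theorem exists_rat_add_rat_mul_sqrt {d : ℕ} (x : Fd d) :
    ∃ p q : ℚ, x = (p : Fd d) + q * sqrtFd d := by
  suffices h : ∀ y ∈ IntermediateField.adjoin ℚ {Real.sqrt d},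
      ∃ p q : ℚ, y = p + q * Real.sqrt d by
    obtain ⟨p, q, h⟩ := h x x.2
    refine ⟨p, q, Subtype.ext ?_⟩
    push_cast
    rw [coe_sqrtFd, h]
  have hs : Real.sqrt d * Real.sqrt d = d := Real.mul_self_sqrt d.cast_nonneg
  intro y hy
  induction hy using IntermediateField.adjoin_induction with
  | mem y hy => exact ⟨0, 1, by rw [Set.mem_singleton_iff.1 hy]; simp⟩
  | algebraMap r => exact ⟨r, 0, by simp⟩
  | add y z _ _ hy hz =>
    obtain ⟨a, b, rfl⟩ := hy
    obtain ⟨a', b', rfl⟩ := hz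
    exact ⟨a + a', b + b', by push_cast; ring⟩
  | mul y z _ _ hy hz =>
    obtain ⟨a, b, rfl⟩ := hy
    obtain ⟨a', b', rfl⟩ := hz
    exact ⟨a * a' + b * b' * d, a * b' + b * a', by push_cast; linear_combination (b * b' : ℝ) * hs⟩
  | inv y _ hy =>
    obtain ⟨a, b, rfl⟩ := hy
    by_cases h0 : (a : ℝ) + b * Real.sqrt d = 0
    · exact ⟨0, 0, by simp [h0]⟩
    by_cases h1 : (a : ℝ) - b * Real.sqrt d = 0
    · refine ⟨(2 * a)⁻¹, 0, ?_⟩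
      push_cast
      rw [show (a : ℝ) + b * Real.sqrt d = 2 * a by linarith]
      ring
    · refine ⟨a / (a ^ 2 - d * b ^ 2), -b / (a ^ 2 - d * b ^ 2), ?_⟩
      have h2 : (a : ℝ) ^ 2 - d * b ^ 2 = (a + b * Real.sqrt d) * (a - b * Real.sqrt d) := by
        linear_combination (b : ℝ) ^ 2 * hs
      push_cast
      rw [h2]
      field_simp
      ring

theorem exists_algHom_sqrtFd_neg {d : ℕ} (hsq : ¬ IsSquare d) :
    ∃ σ : Fd d →ₐ[ℚ] ℝ, σ (sqrtFd d) = -Real.sqrt d := by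
  have hirr : Irreducible (Polynomial.X ^ 2 - Polynomial.C (d : ℚ)) := by
    rw [X_pow_sub_C_irreducible_iff_of_prime Nat.prime_two]
    intro b hb
    exact hsq (Rat.isSquare_natCast_iff.1 ⟨b, by rw [← hb, sq]⟩)
  have hs : Real.sqrt d ^ 2 = d := Real.sq_sqrt d.cast_nonneg
  have hmin : Polynomial.X ^ 2 - Polynomial.C (d : ℚ) = minpoly ℚ (Real.sqrt d) := by
    apply minpoly.eq_of_irreducible_of_monic hirr
    · simp [hs]
    · exact Polynomial.monic_X_pow_sub_C _ two_ne_zero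
  have hint : IsIntegral ℚ (Real.sqrt d) :=
    ⟨_, Polynomial.monic_X_pow_sub_C (d : ℚ) two_ne_zero, by simp [hs]⟩
  refine ⟨(IntermediateField.algHomAdjoinIntegralEquiv ℚ hint).symm ⟨-Real.sqrt d, ?_⟩, ?_⟩
  · rw [Polynomial.mem_aroots, ← hmin]
    exact ⟨hirr.ne_zero, by simp [hs]⟩
  · exact IntermediateField.algHomAdjoinIntegralEquiv_symm_apply_gen ℚ hint _

theorem exists_int_of_isIntegral_rat {K : Type*} [Field K] [CharZero K] {r : ℚ}
    (h : IsIntegral ℤ (r : K)) : ∃ n : ℤ, r = n := by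
  have h' : IsIntegral ℤ r := by
    rw [← isIntegral_algebraMap_iff (algebraMap ℚ K).injective]
    simpa using h
  obtain ⟨n, hn⟩ := IsIntegrallyClosed.isIntegral_iff.1 h'
  exact ⟨n, by simpa using hn.symm⟩

/-- Every integer of `ℚ(√d)` has the form `b + a ω_d`, compatibly with conjugation. -/
theorem exists_int_add_int_mul_omega {d : ℕ} (hd : Squarefree d)
    {σ : Fd d →ₐ[ℚ] ℝ} (hσ : σ (sqrtFd d) = -Real.sqrt d) {x : Fd d} (hx : IsIntegral ℤ x) :
    ∃ b a : ℤ, (x : ℝ) = b + a * omegaR d ∧ σ x = b + a * omegaConjR d := by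
  obtain ⟨p, q, rfl⟩ := exists_rat_add_rat_mul_sqrt x
  have hs : Real.sqrt d * Real.sqrt d = d := Real.mul_self_sqrt d.cast_nonneg
  have hσx : σ ((p : Fd d) + q * sqrtFd d) = p - q * Real.sqrt d := by
    rw [map_add, map_mul, hσ, map_ratCast, map_ratCast]
    ring
  have hvx : (((p : Fd d) + q * sqrtFd d : Fd d) : ℝ) = p + q * Real.sqrt d := by
    push_cast
    rw [coe_sqrtFd]
  have i1 : IsIntegral ℤ ((p : ℝ) + q * Real.sqrt d) := by
    rw [← hvx]
    exact hx.map ((Fd d).val.restrictScalars ℤ)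
  have i2 : IsIntegral ℤ ((p : ℝ) - q * Real.sqrt d) := by
    rw [← hσx]
    exact hx.map (σ.restrictScalars ℤ)
  obtain ⟨s, hs'⟩ : ∃ s : ℤ, 2 * p = s := by
    apply exists_int_of_isIntegral_rat (K := ℝ)
    have h := i1.add i2
    rw [show (p : ℝ) + q * Real.sqrt d + (p - q * Real.sqrt d) = ((2 * p : ℚ) : ℝ) by
      push_cast; ring] at h
    exact h
  obtain ⟨n, hn⟩ : ∃ n : ℤ, p ^ 2 - d * q ^ 2 = n := by
    apply exists_int_of_isIntegral_rat (K := ℝ)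
    have h := i1.mul i2
    rw [show ((p : ℝ) + q * Real.sqrt d) * (p - q * Real.sqrt d) =
        ((p ^ 2 - d * q ^ 2 : ℚ) : ℝ) by
      push_cast; linear_combination -(q : ℝ) ^ 2 * hs] at h
    exact h
  obtain ⟨t, ht⟩ : ∃ t : ℤ, 2 * q = t := by
    apply Rat.exists_int_eq_of_squarefree_mul_sq hd (n := s ^ 2 - 4 * n)
    push_cast
    rw [← hs', ← hn]
    ring
  have key : s ^ 2 - d * t ^ 2 = 4 * n := by
    have : (s : ℚ) ^ 2 - d * t ^ 2 = 4 * n := by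
      rw [← hs', ← ht, ← hn]
      ring
    exact_mod_cast this
  have hp : (p : ℝ) = s / 2 := by
    have : (2 : ℝ) * p = s := by exact_mod_cast hs'
    linarith
  have hq : (q : ℝ) = t / 2 := by
    have : (2 : ℝ) * q = t := by exact_mod_cast ht
    linarith
  rw [hσx, hvx, hp, hq]
  have h4 : d % 4 ≠ 0 := by
    intro h
    have := Nat.isUnit_iff.1 (hd 2 (by omega))
    omega
  have hdd : (d : ℤ) = 4 * (d / 4 : ℕ) + (d % 4 : ℕ) := by omega
  have hlt : d % 4 < 4 := Nat.mod_lt _ (by norm_num)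
  generalize hk : d / 4 = k at hdd
  by_cases h1 : d % 4 = 1
  · have hpar : ∃ b : ℤ, s = t + 2 * b := by
      rw [hdd, h1] at key
      rcases Int.even_or_odd' s with ⟨s', rfl | rfl⟩ <;>
      rcases Int.even_or_odd' t with ⟨t', rfl | rfl⟩
      · exact ⟨s' - t', by ring⟩
      · ring_nf at key
        omega
      · ring_nf at key
        omega
      · exact ⟨s' - t', by ring⟩
    obtain ⟨b, rfl⟩ := hpar
    refine ⟨b, t, ?_, ?_⟩
    · simp only [omegaR, if_pos h1]
      push_cast
      ring
    · simp only [omegaConjR, if_pos h1]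
      push_cast
      ring
  · have hpar : ∃ b a : ℤ, s = 2 * b ∧ t = 2 * a := by
      rw [hdd] at key
      have h23 : d % 4 = 2 ∨ d % 4 = 3 := by omega
      rcases Int.even_or_odd' s with ⟨s', rfl | rfl⟩ <;>
      rcases Int.even_or_odd' t with ⟨t', rfl | rfl⟩
      · exact ⟨s', t', rfl, rfl⟩
      all_goals
        exfalso
        rcases h23 with h | h <;> rw [h] at key <;> ring_nf at key <;> omega
    obtain ⟨b, a, rfl, rfl⟩ := hpar
    refine ⟨b, a, ?_, ?_⟩
    · simp only [omegaR, if_neg h1]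
      push_cast
      ring
    · simp only [omegaConjR, if_neg h1]
      push_cast
      ring

namespace QuadLattice

variable {d : ℕ} (L : QuadLattice d)

theorem B_add_right (x y z : L.carrier) : L.B x (y + z) = L.B x y + L.B x z := by
  rw [L.B_symm, L.B_add_left, L.B_symm y, L.B_symm z]

theorem B_smul_right (a : Od d) (x y : L.carrier) : L.B x (a • y) = (a : Fd d) * L.B x y := by
  rw [L.B_symm, L.B_smul_left, L.B_symm]

theorem B_zero_right (x : L.carrier) : L.B x 0 = 0 := by
  simpa using L.B_smul_right 0 x 0

variable {L}

theorem PosDef.map_Q_nonneg (h : L.PosDef) (σ : Fd d →ₐ[ℚ] ℝ) (x : L.carrier) :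
    0 ≤ σ (L.Q x) := by
  by_cases hx : x = 0
  · rw [hx, ← L.B_self, L.B_zero_right, map_zero]
  · exact (h x hx σ).le

/-- The Cauchy–Schwarz inequality at each real embedding. -/
theorem PosDef.map_B_sq_le (h : L.PosDef) (hcl : L.IsClassic) (σ : Fd d →ₐ[ℚ] ℝ)
    (v w : L.carrier) : σ (L.B v w) ^ 2 ≤ σ (L.Q v) * σ (L.Q w) := by
  by_cases hw : w = 0
  · rw [hw, L.B_zero_right, map_zero, zero_pow two_ne_zero]
    exact mul_nonneg (h.map_Q_nonneg σ v) (h.map_Q_nonneg σ 0)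
  have hpos : 0 < σ (L.Q w) := h w hw σ
  let b : Od d := ⟨L.B v w, hcl v w⟩
  have hb : (b : Fd d) = L.B v w := rfl
  have hu := h.map_Q_nonneg σ (L.Q w • v + (-b) • w)
  have hcalc : (L.Q (L.Q w • v + (-b) • w) : Fd d) =
      (L.Q w : Fd d) * ((L.Q v : Fd d) * L.Q w - L.B v w ^ 2) := by
    rw [← L.B_self (L.Q w • v + (-b) • w)]
    simp only [B_add_right, B_add_left, B_smul_left, B_smul_right]
    simp only [B_self, L.B_symm w v, map_neg, hb]
    ring
  rw [hcalc, map_mul, map_sub, map_mul, map_pow] at hu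
  linarith [nonneg_of_mul_nonneg_right hu hpos]

end QuadLattice

theorem omegaR_eq_conj_add_sqrt_Delta (d : ℕ) :
    omegaR d = omegaConjR d + Real.sqrt (Delta d) := by
  unfold omegaR omegaConjR Delta
  split_ifs
  · ring
  · push_cast
    rw [Real.sqrt_mul (by norm_num), show (4 : ℝ) = 2 ^ 2 by norm_num,
      Real.sqrt_sq (by norm_num)]
    ring

/-- The conjugating embedding sends `m + k ω_d` to `m + k ω̄_d`. -/
theorem map_eq_of_coe_eq {d : ℕ} {σ : Fd d →ₐ[ℚ] ℝ} (hσ : σ (sqrtFd d) = -Real.sqrt d)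
    {x : Fd d} {m k : ℤ} (hx : (x : ℝ) = m + k * omegaR d) : σ x = m + k * omegaConjR d := by
  unfold omegaR at hx
  unfold omegaConjR
  split_ifs at hx ⊢
  · have h : x = (m : Fd d) + k * ((1 + sqrtFd d) / 2) := by
      apply Subtype.ext
      push_cast
      rw [hx, coe_sqrtFd]
      rfl
    simp only [h, map_add, map_mul, map_div₀, map_intCast, map_one, map_ofNat, hσ]
    ring
  · have h : x = (m : Fd d) + k * sqrtFd d := by
      apply Subtype.ext
      push_cast
      rw [hx, coe_sqrtFd]
    simp only [h, map_add, map_mul, map_intCast, hσ]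

theorem sq_le_mul_of_sq_add_mul_le {a n m : ℤ} {D e f g : ℝ} (hD : 10000 < D)
    (he : |e| < 1) (hf0 : 0 ≤ f) (hf : f < 1) (hg0 : 0 ≤ g) (hg : g < 1)
    (hn0 : 0 ≤ n) (hn : n ≤ 15) (hm0 : 0 ≤ m) (hm : m ≤ 15)
    (h : (e + a * D) ^ 2 ≤ (f + n * D) * (g + m * D)) : a ^ 2 ≤ n * m := by
  by_contra! hlt
  have hlt' : (n : ℝ) * m + 1 ≤ |(a : ℝ)| ^ 2 := by
    rw [sq_abs]
    exact_mod_cast hlt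
  have hnm : (n : ℝ) * m ≤ 225 := by
    have : n * m ≤ 225 := by nlinarith
    exact_mod_cast this
  have hn' : (n : ℝ) ≤ 15 := by exact_mod_cast hn
  have hm' : (m : ℝ) ≤ 15 := by exact_mod_cast hm
  have hn0' : (0 : ℝ) ≤ n := by exact_mod_cast hn0
  have hm0' : (0 : ℝ) ≤ m := by exact_mod_cast hm0
  have hcross : -|(a : ℝ)| ≤ e * a := by
    have h1 : |e * a| ≤ |(a : ℝ)| := by
      rw [abs_mul]
      nlinarith [abs_nonneg (a : ℝ)]
    linarith [neg_abs_le (e * a)]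
  have hfg : f * g ≤ 1 := by nlinarith
  have hfm : f * m ≤ 15 := by nlinarith
  have hgn : g * n ≤ 15 := by nlinarith
  have hA : (a : ℝ) ^ 2 = |(a : ℝ)| ^ 2 := (sq_abs _).symm
  have hA0 := abs_nonneg (a : ℝ)
  generalize |(a : ℝ)| = A at *
  have hbound : (A ^ 2 - n * m) * D ≤ 31 + 2 * A := by
    have h1 : ((A ^ 2 - n * m) * D) * D ≤ (31 + 2 * A) * D := by
      have hD0 : 0 ≤ D := by linarith
      have h2 := mul_le_mul_of_nonneg_right hcross hD0
      have h3 := mul_le_mul_of_nonneg_right hfm hD0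
      have h4 := mul_le_mul_of_nonneg_right hgn hD0
      have h5 : (a : ℝ) ^ 2 * D ^ 2 = A ^ 2 * D ^ 2 := by rw [hA]
      have h6 := sq_nonneg e
      ring_nf at h h2 h3 h4 h5 ⊢
      linarith
    exact le_of_mul_le_mul_right h1 (by linarith)
  rcases le_or_gt A 100 with hA1 | hA1 <;> nlinarith


/-- **Lemma (Statement 17).** Let `Δ_d > (4·4!·4!·15⁴)²`, let `L` be a positive
definite classic quadratic `𝒪_F`-lattice and `v, w ∈ L` with `Q(v) = m_i + i·ω_d`
and `Q(w) = m_j + j·ω_d` for some `1 ≤ i, j ≤ 15`, where `m_k = -⌊k·ω̄_d⌋`. Then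
`B(v,w) = ±(-⌊a·ω̄_d⌋ + a·ω_d)` for some `a ∈ ℤ` with `|a| ≤ √(i·j) ≤ 15`. -/
theorem B_eq_pm_floor_rep
    (d : ℕ) (hd : Squarefree d) (hd1 : 1 < d)
    (hΔ : (4 * Nat.factorial 4 * Nat.factorial 4 * 15 ^ 4) ^ 2 < Delta d)
    (L : QuadLattice d) (hcl : L.IsClassic) (hpd : L.PosDef)
    (i j : ℕ) (hi1 : 1 ≤ i) (hi15 : i ≤ 15) (hj1 : 1 ≤ j) (hj15 : j ≤ 15)
    (v w : L.carrier)
    (hv : ((L.Q v : Fd d) : ℝ)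
        = ((-⌊(i : ℝ) * omegaConjR d⌋ : ℤ) : ℝ) + (i : ℝ) * omegaR d)
    (hw : ((L.Q w : Fd d) : ℝ)
        = ((-⌊(j : ℝ) * omegaConjR d⌋ : ℤ) : ℝ) + (j : ℝ) * omegaR d) :
    ∃ a : ℤ,
      (((L.B v w) : ℝ)
          = ((-⌊(a : ℝ) * omegaConjR d⌋ : ℤ) : ℝ) + (a : ℝ) * omegaR d ∨
        ((L.B v w) : ℝ)
          = -(((-⌊(a : ℝ) * omegaConjR d⌋ : ℤ) : ℝ) + (a : ℝ) * omegaR d)) ∧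
      (|a| : ℝ) ≤ Real.sqrt (i * j) ∧ Real.sqrt ((i : ℝ) * j) ≤ 15 := by
  have hsq := not_isSquare_of_squarefree hd hd1
  obtain ⟨σ, hσ⟩ := exists_algHom_sqrtFd_neg hsq
  obtain ⟨b, a, hB, hσB⟩ := exists_int_add_int_mul_omega hd hσ (hcl v w)
  have hσv := map_eq_of_coe_eq (k := i) hσ (by exact_mod_cast hv)
  have hσw := map_eq_of_coe_eq (k := j) hσ (by exact_mod_cast hw)
  have hcs : (L.B v w : ℝ) ^ 2 ≤ ((L.Q v : Fd d) : ℝ) * ((L.Q w : Fd d) : ℝ) :=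
    hpd.map_B_sq_le hcl (Fd d).val v w
  have hcs' := hpd.map_B_sq_le hcl σ v w
  have hD : (10000 : ℝ) < Real.sqrt (Delta d) := by
    apply Real.lt_sqrt_of_sq_lt
    have : 10000 ^ 2 < Delta d := lt_trans (by norm_num [Nat.factorial]) hΔ
    exact_mod_cast this
  rw [hσB, hσv, hσw] at hcs'
  rw [hB, hv, hw, omegaR_eq_conj_add_sqrt_Delta] at hcs
  rw [hB]
  have hfv0 := Int.floor_le ((i : ℝ) * omegaConjR d)
  have hfv1 := Int.lt_floor_add_one ((i : ℝ) * omegaConjR d)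
  have hfw0 := Int.floor_le ((j : ℝ) * omegaConjR d)
  have hfw1 := Int.lt_floor_add_one ((j : ℝ) * omegaConjR d)
  push_cast at hcs hcs'
  have he : |(b : ℝ) + a * omegaConjR d| < 1 := by
    rw [← sq_lt_one_iff_abs_lt_one]
    nlinarith
  have ha : a ^ 2 ≤ (i : ℤ) * j := by
    refine sq_le_mul_of_sq_add_mul_le (D := Real.sqrt (Delta d)) hD he
      (f := -⌊(i : ℝ) * omegaConjR d⌋ + i * omegaConjR d)
      (g := -⌊(j : ℝ) * omegaConjR d⌋ + j * omegaConjR d)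
      (by linarith) (by linarith) (by linarith) (by linarith)
      (by omega) (by omega) (by omega) (by omega) ?_
    push_cast
    calc _ = _ := by ring
      _ ≤ _ := hcs
      _ = _ := by ring
  have ha' : (a : ℝ) ^ 2 ≤ i * j := by exact_mod_cast ha
  have hij : Real.sqrt ((i : ℝ) * j) ≤ 15 := by
    apply Real.sqrt_le_iff.2 ⟨by norm_num, ?_⟩
    have : i * j ≤ 15 ^ 2 := by nlinarith
    exact_mod_cast this
  obtain ⟨he0, he1⟩ := abs_lt.1 he
  rcases le_or_gt 0 ((b : ℝ) + a * omegaConjR d) with hs | hs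
  · refine ⟨a, Or.inl ?_, Real.abs_le_sqrt ha', hij⟩
    have : ⌊(a : ℝ) * omegaConjR d⌋ = -b := by
      rw [Int.floor_eq_iff]
      push_cast
      constructor <;> linarith
    rw [this, neg_neg]
  · refine ⟨-a, Or.inr ?_, ?_, hij⟩
    · have : ⌊((-a : ℤ) : ℝ) * omegaConjR d⌋ = b := by
        rw [Int.floor_eq_iff]
        push_cast
        constructor <;> linarith
      rw [this]
      push_cast
      ring
    · push_cast
      rw [abs_neg]
      exact Real.abs_le_sqrt ha'
end
end
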